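/- Let I be an open interval of ℝ, ν a signed Radon measure on I, and x₀ < x₁ two points of I. Suppose there is a solution u of u″ + uν = 0 on I with u > 0 on (x₀, x₁) and u(x₀) = u(x₁) = 0. Then every solution v of u″ + uν = 0 on I that is not a scalar multiple of u has exactly one zero in the open interval (x₀, x₁). -/

import Mathlib

open MeasureTheory Set

/-- `u` is a solution of `u'' + u ν = 0` on `I`, where the signed Radon measure `ν`
is represented as the difference `νp - νm` of two (locally finite on `I`) positive
Borel measures, and `g` is the right-continuous right-derivative of `u`. -/
def IsSolutionSM (I : Set ℝ) (νp νm : Measure ℝ) (u g : ℝ → ℝ) : Prop :=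
  ContinuousOn u I ∧
  (∀ x ∈ I, ContinuousWithinAt g (Ici x) x) ∧
  (∀ x' ∈ I, ∀ x ∈ I, u x = u x' + ∫ t in x'..x, g t) ∧
  (∀ x' ∈ I, ∀ x ∈ I, x' ≤ x →
    g x - g x' = -((∫ t in Ioc x' x, u t ∂νp) - ∫ t in Ioc x' x, u t ∂νm))

open Topology Filter

/-- A function whose increments are bounded by products of increments of `x` and of some other
function takes equal values at the endpoints. -/
lemma eq_of_abs_sub_le_mul_mul {F φ : ℝ → ℝ} {a b C : ℝ} (hab : a ≤ b)
    (h : ∀ x ∈ Icc a b, ∀ y ∈ Icc a b, x ≤ y → |F y - F x| ≤ C * (y - x) * (φ y - φ x)) :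
    F a = F b := by
  have key : ∀ n : ℕ, 0 < n → n * |F b - F a| ≤ C * (b - a) * (φ b - φ a) := by
    intro n hn
    have hn' : (0 : ℝ) < n := by exact_mod_cast hn
    set d := (b - a) / n with hd
    have hd0 : 0 ≤ d := div_nonneg (sub_nonneg.2 hab) hn'.le
    have hnd : n * d = b - a := by rw [hd]; field_simp
    have hmem : ∀ k : ℕ, k ≤ n → a + k * d ∈ Icc a b := by
      intro k hk
      have h1 : (k : ℝ) * d ≤ n * d := by gcongr
      exact ⟨by nlinarith [mul_nonneg k.cast_nonneg hd0], by linarith⟩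
    have hind : ∀ k : ℕ, k ≤ n → |F (a + k * d) - F a| ≤ C * d * (φ (a + k * d) - φ a) := by
      intro k
      induction k with
      | zero => intro _; simp
      | succ k ih =>
        intro hk
        have h1 := ih (by omega)
        have h2 := h _ (hmem k (by omega)) _ (hmem (k + 1) hk) (by push_cast; linarith)
        have h3 : a + ((k + 1 : ℕ) : ℝ) * d - (a + k * d) = d := by push_cast; ring
        rw [h3] at h2
        have h4 := abs_sub_le (F (a + ((k + 1 : ℕ) : ℝ) * d)) (F (a + k * d)) (F a)
        linarith
    have h5 := hind n le_rfl
    rw [hnd, add_sub_cancel] at h5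
    calc n * |F b - F a| ≤ n * (C * d * (φ b - φ a)) := by gcongr
      _ = C * (n * d) * (φ b - φ a) := by ring
      _ = _ := by rw [hnd]
  by_contra hne
  have hpos : 0 < |F b - F a| := abs_pos.2 (sub_ne_zero.2 (Ne.symm hne))
  obtain ⟨n, hn⟩ := exists_nat_gt (C * (b - a) * (φ b - φ a) / |F b - F a|)
  rw [div_lt_iff₀ hpos] at hn
  have := key (n + 1) n.succ_pos
  push_cast at this
  linarith

namespace IsSolutionSM

variable {I : Set ℝ} {νp νm : Measure ℝ} {u g v gv : ℝ → ℝ}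

lemma continuousOn_Icc (hu : IsSolutionSM I νp νm u g) (hI : I.OrdConnected) {a b : ℝ}
    (ha : a ∈ I) (hb : b ∈ I) : ContinuousOn u (Icc a b) :=
  hu.1.mono (hI.out ha hb)

lemma abs_sub_le_measureReal (hu : IsSolutionSM I νp νm u g)
    (hνp : ∀ x ∈ I, ∀ y ∈ I, νp (Icc x y) < ⊤) (hνm : ∀ x ∈ I, ∀ y ∈ I, νm (Icc x y) < ⊤)
    {x y K : ℝ} (hx : x ∈ I) (hy : y ∈ I) (hxy : x ≤ y) (hK : ∀ t ∈ Icc x y, |u t| ≤ K) :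
    |g y - g x| ≤ K * (νp.real (Ioc x y) + νm.real (Ioc x y)) := by
  have hp := norm_setIntegral_le_of_norm_le_const (μ := νp) (s := Ioc x y) (f := u) (C := K)
    ((measure_mono Ioc_subset_Icc_self).trans_lt (hνp x hx y hy))
    (fun t ht => hK t (Ioc_subset_Icc_self ht))
  have hm := norm_setIntegral_le_of_norm_le_const (μ := νm) (s := Ioc x y) (f := u) (C := K)
    ((measure_mono Ioc_subset_Icc_self).trans_lt (hνm x hx y hy))
    (fun t ht => hK t (Ioc_subset_Icc_self ht))
  rw [hu.2.2.2 x hx y hy hxy, abs_neg, mul_add]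
  exact (abs_sub _ _).trans (add_le_add hp hm)

/-- On a compact subinterval of `I`, the increments of the right-derivative of any solution are
controlled by those of a monotone function depending only on the measure. -/
lemma exists_monotoneOn_control (hI : I.OrdConnected)
    (hνp : ∀ x ∈ I, ∀ y ∈ I, νp (Icc x y) < ⊤) (hνm : ∀ x ∈ I, ∀ y ∈ I, νm (Icc x y) < ⊤)
    {a b : ℝ} (ha : a ∈ I) (hb : b ∈ I) :
    ∃ φ : ℝ → ℝ, MonotoneOn φ (Icc a b) ∧ ∀ u g : ℝ → ℝ, IsSolutionSM I νp νm u g →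
      ∀ x ∈ Icc a b, ∀ y ∈ Icc a b, x ≤ y → ∀ K : ℝ, (∀ t ∈ Icc x y, |u t| ≤ K) →
        |g y - g x| ≤ K * (φ y - φ x) := by
  have key : ∀ μ : Measure ℝ, (∀ x ∈ I, ∀ y ∈ I, μ (Icc x y) < ⊤) →
      ∀ x ∈ Icc a b, ∀ y ∈ Icc a b, x ≤ y →
        μ.real (Ioc x y) = μ.real (Ioc a y) - μ.real (Ioc a x) := by
    intro μ hμ x hx y hy hxy
    have hfin : ∀ s t, s ∈ Icc a b → t ∈ Icc a b → μ (Ioc s t) ≠ ⊤ := fun s t hs ht =>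
      ((measure_mono Ioc_subset_Icc_self).trans_lt
        (hμ s (hI.out ha hb hs) t (hI.out ha hb ht))).ne
    have hab : a ∈ Icc a b := ⟨le_rfl, hx.1.trans hx.2⟩
    rw [← Ioc_union_Ioc_eq_Ioc hx.1 hxy,
      measureReal_union (Ioc_disjoint_Ioc_of_le le_rfl) measurableSet_Ioc
        (hfin a x hab hx) (hfin x y hx hy)]
    ring
  refine ⟨fun t => νp.real (Ioc a t) + νm.real (Ioc a t), ?_, ?_⟩
  · intro x hx y hy hxy
    have h1 := key νp hνp x hx y hy hxy
    have h2 := key νm hνm x hx y hy hxy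
    have h3 : 0 ≤ νp.real (Ioc x y) := measureReal_nonneg
    have h4 : 0 ≤ νm.real (Ioc x y) := measureReal_nonneg
    dsimp only
    linarith
  · intro u g hu x hx y hy hxy K hK
    have := hu.abs_sub_le_measureReal hνp hνm (hI.out ha hb hx) (hI.out ha hb hy) hxy hK
    rw [key νp hνp x hx y hy hxy, key νm hνm x hx y hy hxy] at this
    convert this using 2
    ring

lemma exists_bound (hu : IsSolutionSM I νp νm u g) (hI : I.OrdConnected) {a b : ℝ}
    (ha : a ∈ I) (hb : b ∈ I) : ∃ K, 0 ≤ K ∧ ∀ t ∈ Icc a b, |u t| ≤ K := by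
  obtain ⟨K, hK⟩ := isCompact_Icc.exists_bound_of_continuousOn (hu.continuousOn_Icc hI ha hb)
  exact ⟨max K 0, le_max_right _ _, fun t ht => (hK t ht).trans (le_max_left _ _)⟩

lemma exists_bound_deriv (hu : IsSolutionSM I νp νm u g) (hI : I.OrdConnected)
    (hνp : ∀ x ∈ I, ∀ y ∈ I, νp (Icc x y) < ⊤) (hνm : ∀ x ∈ I, ∀ y ∈ I, νm (Icc x y) < ⊤)
    {a b : ℝ} (ha : a ∈ I) (hb : b ∈ I) : ∃ K, 0 ≤ K ∧ ∀ t ∈ Icc a b, |g t| ≤ K := by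
  obtain ⟨φ, hφ, hc⟩ := exists_monotoneOn_control hI hνp hνm ha hb
  obtain ⟨K, hK0, hK⟩ := hu.exists_bound hI ha hb
  refine ⟨max (|g a| + K * (φ b - φ a)) 0, le_max_right _ _, fun t ht => le_max_of_le_left ?_⟩
  have hab : a ≤ b := ht.1.trans ht.2
  have h1 := hc u g hu a ⟨le_rfl, hab⟩ t ht ht.1 K fun s hs => hK s ⟨hs.1, hs.2.trans ht.2⟩
  have h2 : K * (φ t - φ a) ≤ K * (φ b - φ a) := by
    gcongr
    exact hφ ht ⟨hab, le_rfl⟩ ht.2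
  have h3 := abs_sub_abs_le_abs_sub (g t) (g a)
  linarith

lemma intervalIntegrable (hu : IsSolutionSM I νp νm u g) (hI : I.OrdConnected)
    (hνp : ∀ x ∈ I, ∀ y ∈ I, νp (Icc x y) < ⊤) (hνm : ∀ x ∈ I, ∀ y ∈ I, νm (Icc x y) < ⊤)
    {a b : ℝ} (ha : a ∈ I) (hb : b ∈ I) : IntervalIntegrable g volume a b := by
  wlog hab : a ≤ b generalizing a b
  · exact (this hb ha (le_of_not_ge hab)).symm
  obtain ⟨φ, hφ, hc⟩ := exists_monotoneOn_control hI hνp hνm ha hb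
  obtain ⟨K, hK0, hK⟩ := hu.exists_bound hI ha hb
  have h1 : MonotoneOn (fun t => K * φ t) (Icc a b) := fun x hx y hy hxy =>
    mul_le_mul_of_nonneg_left (hφ hx hy hxy) hK0
  have h2 : MonotoneOn (fun t => g t + K * φ t) (Icc a b) := by
    intro x hx y hy hxy
    have := hc u g hu x hx y hy hxy K fun s hs => hK s ⟨hx.1.trans hs.1, hs.2.trans hy.2⟩
    have := (abs_le.1 this).1
    dsimp only
    linarith
  rw [← uIcc_of_le hab] at h1 h2
  refine (h2.intervalIntegrable.sub h1.intervalIntegrable).congr ?_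
  exact fun t _ => by simp

lemma linear_combination (hu : IsSolutionSM I νp νm u g) (hv : IsSolutionSM I νp νm v gv)
    (hI : I.OrdConnected)
    (hνp : ∀ x ∈ I, ∀ y ∈ I, νp (Icc x y) < ⊤) (hνm : ∀ x ∈ I, ∀ y ∈ I, νm (Icc x y) < ⊤)
    (α β : ℝ) :
    IsSolutionSM I νp νm (fun x => α * u x + β * v x) (fun x => α * g x + β * gv x) := by
  refine ⟨(hu.1.const_mul α).add (hv.1.const_mul β), fun x hx =>
    ((hu.2.1 x hx).const_mul α).add ((hv.2.1 x hx).const_mul β), fun x' hx' x hx => ?_,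
    fun x' hx' x hx hxx => ?_⟩
  · rw [intervalIntegral.integral_add
      ((hu.intervalIntegrable hI hνp hνm hx' hx).const_mul α)
      ((hv.intervalIntegrable hI hνp hνm hx' hx).const_mul β),
      intervalIntegral.integral_const_mul, intervalIntegral.integral_const_mul]
    linear_combination α * hu.2.2.1 x' hx' x hx + β * hv.2.2.1 x' hx' x hx
  · have hint : ∀ μ : Measure ℝ, (∀ x ∈ I, ∀ y ∈ I, μ (Icc x y) < ⊤) →
        ∀ w : ℝ → ℝ, ContinuousOn w (Icc x' x) → IntegrableOn w (Ioc x' x) μ := by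
      intro μ hμ w hw
      exact (hw.integrableOn_of_subset_isCompact isCompact_Icc measurableSet_Ioc
        Ioc_subset_Icc_self
        ((measure_mono Ioc_subset_Icc_self).trans_lt (hμ x' hx' x hx)).ne)
    have hcu := hu.continuousOn_Icc hI hx' hx
    have hcv := hv.continuousOn_Icc hI hx' hx
    rw [integral_add ((hint νp hνp u hcu).const_mul α) ((hint νp hνp v hcv).const_mul β),
      integral_add ((hint νm hνm u hcu).const_mul α) ((hint νm hνm v hcv).const_mul β)]
    simp only [integral_const_mul]
    linear_combination α * hu.2.2.2 x' hx' x hx hxx + β * hv.2.2.2 x' hx' x hx hxx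

lemma abs_sub_le_of_deriv_bound (hu : IsSolutionSM I νp νm u g) {x y K : ℝ} (hx : x ∈ I)
    (hy : y ∈ I) (hK : ∀ t ∈ uIcc x y, |g t| ≤ K) : |u y - u x| ≤ K * |y - x| := by
  rw [hu.2.2.1 x hx y hy, add_sub_cancel_left]
  exact intervalIntegral.norm_integral_le_of_norm_le_const (f := g) fun t ht =>
    hK t (uIoc_subset_uIcc ht)

lemma wronskian_eq (hu : IsSolutionSM I νp νm u g) (hv : IsSolutionSM I νp νm v gv)
    (hI : I.OrdConnected)
    (hνp : ∀ x ∈ I, ∀ y ∈ I, νp (Icc x y) < ⊤) (hνm : ∀ x ∈ I, ∀ y ∈ I, νm (Icc x y) < ⊤)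
    {a b : ℝ} (ha : a ∈ I) (hb : b ∈ I) :
    u a * gv a - v a * g a = u b * gv b - v b * g b := by
  wlog hab : a ≤ b generalizing a b
  · exact (this hb ha (le_of_not_ge hab)).symm
  obtain ⟨φ, hφ, hc⟩ := exists_monotoneOn_control hI hνp hνm ha hb
  obtain ⟨A, hA0, hA⟩ := hu.exists_bound hI ha hb
  obtain ⟨B, hB0, hB⟩ := hv.exists_bound hI ha hb
  obtain ⟨A', hA'0, hA'⟩ := hu.exists_bound_deriv hI hνp hνm ha hb
  obtain ⟨B', hB'0, hB'⟩ := hv.exists_bound_deriv hI hνp hνm ha hb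
  -- first-order Taylor remainder of a solution
  have taylor : ∀ w gw : ℝ → ℝ, IsSolutionSM I νp νm w gw → ∀ K : ℝ, 0 ≤ K →
      (∀ t ∈ Icc a b, |w t| ≤ K) → ∀ x ∈ Icc a b, ∀ y ∈ Icc a b, x ≤ y →
        |w y - w x - (y - x) * gw x| ≤ K * (y - x) * (φ y - φ x) := by
    intro w gw hw K hK0 hK x hx y hy hxy
    have h1 : w y - w x - (y - x) * gw x = ∫ t in x..y, (gw t - gw x) := by
      rw [intervalIntegral.integral_sub
        (hw.intervalIntegrable hI hνp hνm (hI.out ha hb hx) (hI.out ha hb hy)) (by simp),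
        hw.2.2.1 x (hI.out ha hb hx) y (hI.out ha hb hy)]
      simp
    rw [h1]
    have h2 := intervalIntegral.norm_integral_le_of_norm_le_const (a := x) (b := y)
      (f := fun t => gw t - gw x) (C := K * (φ y - φ x)) fun t ht => by
        rw [uIoc_of_le hxy] at ht
        have htI : t ∈ Icc a b := ⟨hx.1.trans ht.1.le, ht.2.trans hy.2⟩
        refine (hc w gw hw x hx t htI ht.1.le K
          fun s hs => hK s ⟨hx.1.trans hs.1, hs.2.trans htI.2⟩).trans ?_
        gcongr
        exact hφ htI hy ht.2
    rw [abs_of_nonneg (sub_nonneg.2 hxy), Real.norm_eq_abs] at h2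
    linarith
  refine eq_of_abs_sub_le_mul_mul (F := fun t => u t * gv t - v t * g t) (φ := φ)
    (C := 2 * (B * A' + A * B')) hab ?_
  intro x hx y hy hxy
  have hφxy : 0 ≤ φ y - φ x := sub_nonneg.2 (hφ hx hy hxy)
  have hw := hu.linear_combination hv hI hνp hνm (v y) (-u y)
  have hw_le : ∀ t ∈ Icc x y, |v y * u t + -u y * v t| ≤ (B * A' + A * B') * (y - x) := by
    intro t ht
    have h1 := hw.abs_sub_le_of_deriv_bound (K := B * A' + A * B') (hI.out ha hb hy)
      (hI.out ha hb ⟨hx.1.trans ht.1, ht.2.trans hy.2⟩) fun s hs => by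
        rw [uIcc_of_ge ht.2] at hs
        have hs' : s ∈ Icc a b := ⟨(hx.1.trans ht.1).trans hs.1, hs.2.trans hy.2⟩
        refine (abs_add_le _ _).trans ?_
        rw [abs_mul, abs_mul, abs_neg]
        gcongr
        exacts [hB y hy, hA' s hs', hA y hy, hB' s hs']
    have h2 : v y * u t + -u y * v t - (v y * u y + -u y * v y) = v y * u t + -u y * v t := by
      ring
    rw [h2] at h1
    refine h1.trans ?_
    gcongr
    rw [abs_of_nonpos (by linarith [ht.2])]
    linarith [ht.1]
  have h1 := hc _ _ hw x hx y hy hxy _ hw_le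
  have h2 := taylor u g hu A hA0 hA x hx y hy hxy
  have h3 := taylor v gv hv B hB0 hB x hx y hy hxy
  have hyx : 0 ≤ y - x := sub_nonneg.2 hxy
  have h4 : |(u y - u x - (y - x) * g x) * gv x| ≤ A * (y - x) * (φ y - φ x) * B' := by
    rw [abs_mul]
    gcongr
    exact hB' x hx
  have h5 : |(v y - v x - (y - x) * gv x) * g x| ≤ B * (y - x) * (φ y - φ x) * A' := by
    rw [abs_mul]
    gcongr
    exact hA' x hx
  have h6 : u y * gv y - v y * g y - (u x * gv x - v x * g x) =
      -((v y * g y + -u y * gv y) - (v y * g x + -u y * gv x)) +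
        (u y - u x - (y - x) * g x) * gv x - (v y - v x - (y - x) * gv x) * g x := by
    ring
  rw [h6]
  rw [abs_le] at h1 h4 h5 ⊢
  constructor <;> linarith [h1.1, h1.2, h4.1, h4.2, h5.1, h5.2]

lemma exists_local_control (hIopen : IsOpen I) (hI : I.OrdConnected)
    (hνp : ∀ x ∈ I, ∀ y ∈ I, νp (Icc x y) < ⊤) (hνm : ∀ x ∈ I, ∀ y ∈ I, νm (Icc x y) < ⊤)
    {c : ℝ} (hc : c ∈ I) :
    ∃ r > 0, ∃ D ≥ 0, Icc (c - r) (c + r) ⊆ I ∧ ∀ u g : ℝ → ℝ, IsSolutionSM I νp νm u g →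
      ∀ s ∈ Icc (c - r) (c + r), ∀ t ∈ Icc (c - r) (c + r), ∀ K : ℝ,
        (∀ τ ∈ uIcc s t, |u τ| ≤ K) → |g t - g s| ≤ K * D := by
  obtain ⟨r, hr, hrI⟩ := Metric.nhds_basis_closedBall.mem_iff.1 (hIopen.mem_nhds hc)
  rw [Real.closedBall_eq_Icc] at hrI
  have hl : c - r ∈ Icc (c - r) (c + r) := ⟨le_rfl, by linarith⟩
  have hu : c + r ∈ Icc (c - r) (c + r) := ⟨by linarith, le_rfl⟩
  obtain ⟨φ, hφ, hcon⟩ := exists_monotoneOn_control hI hνp hνm (hrI hl) (hrI hu)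
  refine ⟨r, hr, φ (c + r) - φ (c - r), sub_nonneg.2 (hφ hl hu (by linarith)), hrI, ?_⟩
  intro u g hsol s hs t ht K hK
  wlog hst : s ≤ t generalizing s t
  · rw [abs_sub_comm]
    exact this t ht s hs (by rwa [uIcc_comm]) (le_of_not_ge hst)
  rw [uIcc_of_le hst] at hK
  have hK0 : 0 ≤ K := (abs_nonneg _).trans (hK s ⟨le_rfl, hst⟩)
  refine (hcon u g hsol s hs t ht hst K hK).trans ?_
  gcongr
  exacts [hφ ht hu ht.2, hφ hl hs hs.1]

/-- The right-derivative of a solution is continuous at every zero of the solution. -/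
lemma continuousAt_deriv_of_eq_zero (hu : IsSolutionSM I νp νm u g) (hIopen : IsOpen I)
    (hI : I.OrdConnected)
    (hνp : ∀ x ∈ I, ∀ y ∈ I, νp (Icc x y) < ⊤) (hνm : ∀ x ∈ I, ∀ y ∈ I, νm (Icc x y) < ⊤)
    {c : ℝ} (hc : c ∈ I) (huc : u c = 0) : ContinuousAt g c := by
  obtain ⟨r, hr, D, hD, hrI, hcon⟩ := exists_local_control hIopen hI hνp hνm hc
  obtain ⟨G, hG0, hG⟩ := hu.exists_bound_deriv hI hνp hνm
    (hrI ⟨le_rfl, by linarith⟩ : c - r ∈ I) (hrI ⟨by linarith, le_rfl⟩ : c + r ∈ I)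
  have hcr : c ∈ Icc (c - r) (c + r) := ⟨by linarith, by linarith⟩
  have hlim : Tendsto (fun t => G * |t - c| * D) (𝓝 c) (𝓝 0) := by
    have : ContinuousAt (fun t => G * |t - c| * D) c := by fun_prop
    simpa [ContinuousAt] using this
  rw [ContinuousAt, tendsto_iff_norm_sub_tendsto_zero]
  refine squeeze_zero' (Eventually.of_forall fun t => norm_nonneg _) ?_ hlim
  filter_upwards [Icc_mem_nhds (by linarith : c - r < c) (by linarith : c < c + r)] with t ht
  have hsub : uIcc c t ⊆ Icc (c - r) (c + r) := uIcc_subset_Icc hcr ht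
  refine hcon u g hu c hcr t ht _ fun τ hτ => ?_
  have h1 := hu.abs_sub_le_of_deriv_bound hc (hrI (hsub hτ)) fun s hs =>
    hG s (hsub (uIcc_subset_uIcc_left hτ hs))
  rw [huc, sub_zero] at h1
  exact h1.trans (mul_le_mul_of_nonneg_left (abs_sub_left_of_mem_uIcc hτ) hG0)

lemma eq_zero_of_small (hu : IsSolutionSM I νp νm u g) (hI : I.OrdConnected) {p q c D : ℝ}
    (hp : p ∈ I) (hq : q ∈ I) (hc : c ∈ Icc p q)
    (hcon : ∀ K : ℝ, (∀ t ∈ Icc p q, |u t| ≤ K) → ∀ t ∈ Icc p q, |g t - g c| ≤ K * D)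
    (hD : 0 ≤ D) (hsmall : D * (q - p) < 1) (huc : u c = 0) (hgc : g c = 0) :
    ∀ t ∈ Icc p q, u t = 0 ∧ g t = 0 := by
  obtain ⟨m, hm, hmax⟩ := isCompact_Icc.exists_isMaxOn ⟨c, hc⟩
    (hu.continuousOn_Icc hI hp hq).abs
  have hb : ∀ t ∈ Icc p q, |u t| ≤ |u m| := fun t ht => hmax ht
  have hg : ∀ t ∈ Icc p q, |g t| ≤ |u m| * D := by
    simpa [hgc] using hcon _ hb
  have hum : |u m| = 0 := by
    have h1 := hu.abs_sub_le_of_deriv_bound (hI.out hp hq hc) (hI.out hp hq hm)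
      fun s hs => hg s (uIcc_subset_Icc hc hm hs)
    have h2 : |m - c| ≤ q - p := abs_sub_le_iff.2
      ⟨by linarith [hm.2, hc.1], by linarith [hm.1, hc.2]⟩
    rw [huc, sub_zero] at h1
    have h3 : |u m| * D * |m - c| ≤ |u m| * D * (q - p) := by gcongr
    nlinarith [abs_nonneg (u m)]
  intro t ht
  have h1 := hb t ht
  have h2 := hg t ht
  rw [hum] at h1 h2
  rw [zero_mul] at h2
  exact ⟨abs_nonpos_iff.1 h1, abs_nonpos_iff.1 h2⟩

/-- Uniqueness for the initial value problem with zero data. -/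
lemma eq_zero_of_initial (hu : IsSolutionSM I νp νm u g) (hIopen : IsOpen I)
    (hI : I.OrdConnected)
    (hνp : ∀ x ∈ I, ∀ y ∈ I, νp (Icc x y) < ⊤) (hνm : ∀ x ∈ I, ∀ y ∈ I, νm (Icc x y) < ⊤)
    {c : ℝ} (hc : c ∈ I) (huc : u c = 0) (hgc : g c = 0) {x : ℝ} (hx : x ∈ I) : u x = 0 := by
  have hpre : IsPreconnected I := hI.isPreconnected
  refine ((hpre.induction₂ (fun s t => (u s = 0 ∧ g s = 0) ↔ (u t = 0 ∧ g t = 0)) ?_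
    (fun _ _ _ _ _ _ h h' => h.trans h') (fun _ _ _ _ h => h.symm) hc hx).1 ⟨huc, hgc⟩).1
  intro s hs
  obtain ⟨r, hr, D, hD, hrI, hcon⟩ := exists_local_control hIopen hI hνp hνm hs
  obtain ⟨ε, hε, hεr, hεD⟩ : ∃ ε > 0, ε ≤ r ∧ D * (2 * ε) < 1 := by
    refine ⟨min r (1 / (2 * D + 2)), lt_min hr (by positivity), min_le_left _ _, ?_⟩
    have h1 : min r (1 / (2 * D + 2)) ≤ 1 / (2 * D + 2) := min_le_right _ _
    calc D * (2 * min r (1 / (2 * D + 2))) ≤ D * (2 * (1 / (2 * D + 2))) := by gcongr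
      _ < 1 := by
        rw [← mul_assoc, mul_one_div, div_lt_one (by positivity)]
        linarith
  have hsub : Icc (s - ε) (s + ε) ⊆ Icc (s - r) (s + r) :=
    Icc_subset_Icc (by linarith) (by linarith)
  have key : ∀ p ∈ Icc (s - ε) (s + ε), (u p = 0 ∧ g p = 0) →
      ∀ t ∈ Icc (s - ε) (s + ε), u t = 0 ∧ g t = 0 := by
    intro p hp hzero
    refine hu.eq_zero_of_small hI (hrI (hsub ⟨le_rfl, by linarith⟩))
      (hrI (hsub ⟨by linarith, le_rfl⟩)) hp (fun K hK t ht => ?_) hD ?_ hzero.1 hzero.2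
    · exact hcon u g hu p (hsub hp) t (hsub ht) K
        fun τ hτ => hK τ (uIcc_subset_Icc hp ht hτ)
    · convert hεD using 2
      ring
  have hs' : s ∈ Icc (s - ε) (s + ε) := ⟨by linarith, by linarith⟩
  filter_upwards [nhdsWithin_le_nhds
    (Icc_mem_nhds (by linarith : s - ε < s) (by linarith : s < s + ε))] with t ht
  exact ⟨fun h => key s hs' h t ht, fun h => key t ht h s hs'⟩

lemma hasDerivWithinAt_Ici (hu : IsSolutionSM I νp νm u g) (hIopen : IsOpen I)
    (hI : I.OrdConnected)
    (hνp : ∀ x ∈ I, ∀ y ∈ I, νp (Icc x y) < ⊤) (hνm : ∀ x ∈ I, ∀ y ∈ I, νm (Icc x y) < ⊤)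
    {c : ℝ} (hc : c ∈ I) : HasDerivWithinAt u (g c) (Ici c) c := by
  obtain ⟨r, hr, hrI⟩ := Metric.nhds_basis_closedBall.mem_iff.1 (hIopen.mem_nhds hc)
  rw [Real.closedBall_eq_Icc] at hrI
  have hint := hu.intervalIntegrable hI hνp hνm (hrI ⟨le_rfl, by linarith⟩ : c - r ∈ I)
    (hrI ⟨by linarith, le_rfl⟩ : c + r ∈ I)
  rw [intervalIntegrable_iff_integrableOn_Ioc_of_le (by linarith)] at hint
  have hmeas : StronglyMeasurableAtFilter g (𝓝[>] c) :=
    ⟨Ioc (c - r) (c + r), nhdsWithin_le_nhds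
      (Ioc_mem_nhds (by linarith) (by linarith)), hint.aestronglyMeasurable⟩
  have hder := intervalIntegral.integral_hasDerivWithinAt_right (a := c) (b := c) (s := Ici c)
    (t := Ioi c) IntervalIntegrable.refl hmeas ((hu.2.1 c hc).mono Ioi_subset_Ici_self)
  refine (hder.const_add (u c)).congr_of_eventuallyEq ?_ (hu.2.2.1 c hc c hc)
  filter_upwards [nhdsWithin_le_nhds (hIopen.mem_nhds hc)] with t ht
  exact hu.2.2.1 c hc t ht

/-- A solution which is positive just to the right of a zero has nonnegative right-derivative
there. -/
lemma deriv_nonneg_of_pos_right (hu : IsSolutionSM I νp νm u g) (hIopen : IsOpen I)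
    (hI : I.OrdConnected)
    (hνp : ∀ x ∈ I, ∀ y ∈ I, νp (Icc x y) < ⊤) (hνm : ∀ x ∈ I, ∀ y ∈ I, νm (Icc x y) < ⊤)
    {c d : ℝ} (hc : c ∈ I) (hd : d ∈ I) (hcd : c < d) (huc : u c = 0)
    (hpos : ∀ x ∈ Ioo c d, 0 < u x) : 0 ≤ g c := by
  by_contra! hneg
  have hcont := hu.continuousAt_deriv_of_eq_zero hIopen hI hνp hνm hc huc
  obtain ⟨r, hr, hlt⟩ := Metric.nhds_basis_closedBall.mem_iff.1 (hcont.eventually_lt_const hneg)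
  rw [Real.closedBall_eq_Icc] at hlt
  obtain ⟨x, hx, hx'⟩ := exists_between (lt_min hcd (by linarith : c < c + r))
  have hxd : x < d := hx'.trans_le (min_le_left _ _)
  have hxr : x < c + r := hx'.trans_le (min_le_right _ _)
  have h1 : 0 < u x := hpos x ⟨hx, hxd⟩
  rw [hu.2.2.1 c hc x (hI.out hc hd ⟨hx.le, hxd.le⟩), huc, zero_add] at h1
  refine h1.not_ge ?_
  rw [← neg_nonneg, ← intervalIntegral.integral_neg]
  refine intervalIntegral.integral_nonneg hx.le fun t ht => ?_
  have : g t < 0 := hlt ⟨by linarith [ht.1], by linarith [ht.2]⟩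
  linarith

/-- A solution which is positive just to the left of a zero has nonpositive right-derivative
there. -/
lemma deriv_nonpos_of_pos_left (hu : IsSolutionSM I νp νm u g) (hIopen : IsOpen I)
    (hI : I.OrdConnected)
    (hνp : ∀ x ∈ I, ∀ y ∈ I, νp (Icc x y) < ⊤) (hνm : ∀ x ∈ I, ∀ y ∈ I, νm (Icc x y) < ⊤)
    {c d : ℝ} (hc : c ∈ I) (hd : d ∈ I) (hdc : d < c) (huc : u c = 0)
    (hpos : ∀ x ∈ Ioo d c, 0 < u x) : g c ≤ 0 := by
  by_contra! hgc
  have hcont := hu.continuousAt_deriv_of_eq_zero hIopen hI hνp hνm hc huc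
  obtain ⟨r, hr, hgt⟩ := Metric.nhds_basis_closedBall.mem_iff.1 (hcont.eventually_const_lt hgc)
  rw [Real.closedBall_eq_Icc] at hgt
  obtain ⟨x, hx, hx'⟩ := exists_between (max_lt hdc (by linarith : c - r < c))
  have hxd : d < x := (le_max_left _ _).trans_lt hx
  have hxr : c - r < x := (le_max_right _ _).trans_lt hx
  have h1 : 0 < u x := hpos x ⟨hxd, hx'⟩
  have h2 := hu.2.2.1 x (hI.out hd hc ⟨hxd.le, hx'.le⟩) c hc
  have h3 : 0 ≤ ∫ t in x..c, g t := by
    refine intervalIntegral.integral_nonneg hx'.le fun t ht => ?_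
    have : 0 < g t := hgt ⟨by linarith [ht.1], by linarith [ht.2]⟩
    exact this.le
  linarith

/-- If the Wronskian of two solutions vanishes at a point of `I` where the first one is nonzero,
the second one is a scalar multiple of the first. -/
lemma exists_eqOn_mul_of_wronskian_eq_zero (hu : IsSolutionSM I νp νm u g)
    (hv : IsSolutionSM I νp νm v gv) (hIopen : IsOpen I) (hI : I.OrdConnected)
    (hνp : ∀ x ∈ I, ∀ y ∈ I, νp (Icc x y) < ⊤) (hνm : ∀ x ∈ I, ∀ y ∈ I, νm (Icc x y) < ⊤)
    {c : ℝ} (hc : c ∈ I) (hne : u c ≠ 0) (hW : u c * gv c - v c * g c = 0) :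
    EqOn v (fun x => v c / u c * u x) I := by
  intro x hx
  have hw := hv.linear_combination hu hI hνp hνm 1 (-(v c / u c))
  have h0 := hw.eq_zero_of_initial hIopen hI hνp hνm hc (by field_simp; ring)
    (by field_simp; linarith) hx
  dsimp only at h0 ⊢
  linarith

/-- Two distinct zeros of a solution cannot lie in an interval of positivity of another solution
with which it has positive Wronskian. -/
lemma not_two_zeros_of_wronskian_pos (hu : IsSolutionSM I νp νm u g)
    (hv : IsSolutionSM I νp νm v gv) (hIopen : IsOpen I) (hI : I.OrdConnected)
    (hνp : ∀ x ∈ I, ∀ y ∈ I, νp (Icc x y) < ⊤) (hνm : ∀ x ∈ I, ∀ y ∈ I, νm (Icc x y) < ⊤)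
    {a b : ℝ} (ha : a ∈ I) (hb : b ∈ I) (hab : a < b) (hpos : ∀ x ∈ Icc a b, 0 < u x)
    (hW : 0 < u a * gv a - v a * g a) (hva : v a = 0) : v b ≠ 0 := by
  intro hvb
  have hcont : ContinuousOn (v / u) (Icc a b) :=
    (hv.continuousOn_Icc hI ha hb).div (hu.continuousOn_Icc hI ha hb) fun x hx => (hpos x hx).ne'
  have hder : ∀ x ∈ Ico a b, HasDerivWithinAt (v / u)
      ((gv x * u x - v x * g x) / u x ^ 2) (Ici x) x := fun x hx =>
    have hxI := hI.out ha hb (Ico_subset_Icc_self hx)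
    (hv.hasDerivWithinAt_Ici hIopen hI hνp hνm hxI).div
      (hu.hasDerivWithinAt_Ici hIopen hI hνp hνm hxI) (hpos x (Ico_subset_Icc_self hx)).ne'
  have hderpos : ∀ x ∈ Ico a b, 0 ≤ (gv x * u x - v x * g x) / u x ^ 2 := by
    intro x hx
    have hxI := hI.out ha hb (Ico_subset_Icc_self hx)
    have := hu.wronskian_eq hv hI hνp hνm ha hxI
    exact div_nonneg (by linarith [mul_comm (gv x) (u x)]) (sq_nonneg _)
  have hmono : ∀ x ∈ Icc a b, ∀ y ∈ Icc x b, (v / u) x ≤ (v / u) y := by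
    intro x hx y hy
    have hsub : Icc x b ⊆ Icc a b := Icc_subset_Icc_left hx.1
    refine image_le_of_deriv_right_le_deriv_boundary (f := fun _ => (v / u) x) (f' := fun _ => 0)
      (B := v / u) (B' := fun x => (gv x * u x - v x * g x) / u x ^ 2)
      continuousOn_const (fun _ _ => hasDerivWithinAt_const _ _ _) le_rfl (hcont.mono hsub)
      (fun t ht => hder t ⟨hx.1.trans ht.1, ht.2⟩)
      (fun t ht => hderpos t ⟨hx.1.trans ht.1, ht.2⟩) hy
  have hzero : ∀ x ∈ Icc a b, v x = 0 := by
    intro x hx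
    have h1 := hmono a ⟨le_rfl, hab.le⟩ x hx
    have h2 := hmono x hx b ⟨hx.2, le_rfl⟩
    simp only [Pi.div_apply, hva, hvb, zero_div] at h1 h2
    exact (div_eq_zero_iff.1 (le_antisymm h2 h1)).resolve_right (hpos x hx).ne'
  have hd0 : HasDerivWithinAt v 0 (Ici a) a := by
    refine (hasDerivWithinAt_const a (Ici a) (0 : ℝ)).congr_of_eventuallyEq ?_ hva
    filter_upwards [Icc_mem_nhdsGE hab] with t ht using hzero t ht
  have hgva : gv a = 0 :=
    (uniqueDiffWithinAt_Ici a).eq_deriv _ (hv.hasDerivWithinAt_Ici hIopen hI hνp hνm ha) hd0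
  simp [hva, hgva] at hW

end IsSolutionSM

/-- if some solution of `u'' + u ν = 0` is positive on `(x₀, x₁)` and
vanishes at `x₀` and `x₁`, then any solution which is not a scalar multiple of it
has exactly one zero in `(x₀, x₁)`. -/
theorem unique_zero_of_independent_solution
    (I : Set ℝ) (hIopen : IsOpen I) (hIconn : I.OrdConnected)
    (νp νm : Measure ℝ)
    (hνp : ∀ x ∈ I, ∀ y ∈ I, νp (Icc x y) < ⊤)
    (hνm : ∀ x ∈ I, ∀ y ∈ I, νm (Icc x y) < ⊤)
    (x₀ x₁ : ℝ) (hx₀ : x₀ ∈ I) (hx₁ : x₁ ∈ I) (h01 : x₀ < x₁)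
    (u g : ℝ → ℝ) (hu : IsSolutionSM I νp νm u g)
    (hupos : ∀ x ∈ Ioo x₀ x₁, 0 < u x) (hu0 : u x₀ = 0) (hu1 : u x₁ = 0)
    (v gv : ℝ → ℝ) (hv : IsSolutionSM I νp νm v gv)
    (hindep : ∀ c : ℝ, ¬ EqOn v (fun x => c * u x) I) :
    ∃! z : ℝ, z ∈ Ioo x₀ x₁ ∧ v z = 0 := by
  have hmem : ∀ x ∈ Ioo x₀ x₁, x ∈ I := fun x hx => hIconn.out hx₀ hx₁ (Ioo_subset_Icc_self hx)
  have hg0 := hu.deriv_nonneg_of_pos_right hIopen hIconn hνp hνm hx₀ hx₁ h01 hu0 hupos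
  have hg1 := hu.deriv_nonpos_of_pos_left hIopen hIconn hνp hνm hx₁ hx₀ h01 hu1 hupos
  have hW : ∀ x ∈ I, u x * gv x - v x * g x ≠ 0 := by
    obtain ⟨m, hm⟩ := exists_between h01
    intro x hx h0
    rw [hu.wronskian_eq hv hIconn hνp hνm hx (hmem m hm)] at h0
    exact hindep _ (hu.exists_eqOn_mul_of_wronskian_eq_zero hv hIopen hIconn hνp hνm (hmem m hm)
      (hupos m hm).ne' h0)
  -- only the sign of the Wronskian is not normalised
  wlog hsign : 0 < u x₀ * gv x₀ - v x₀ * g x₀ generalizing v gv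
  · have hneg : IsSolutionSM I νp νm (fun x => -v x) (fun x => -gv x) := by
      simpa using hu.linear_combination hv hIconn hνp hνm 0 (-1)
    have := this (fun x => -v x) (fun x => -gv x) hneg
      (fun c hc => hindep (-c) fun x hx => by
        have := hc hx
        dsimp only at this ⊢
        linarith)
      (fun x hx h0 => hW x hx (by linarith))
      (by
        have := lt_of_le_of_ne (not_lt.1 hsign) (hW x₀ hx₀)
        linarith)
    simpa using this
  have hW1 := hu.wronskian_eq hv hIconn hνp hνm hx₀ hx₁
  have hsign1 := hsign
  rw [hW1, hu1, zero_mul, zero_sub] at hsign1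
  have hsign0 := hsign
  rw [hu0, zero_mul, zero_sub] at hsign0
  have hv0 : v x₀ < 0 := by
    by_contra! h
    nlinarith
  have hv1 : 0 < v x₁ := by
    by_contra! h
    nlinarith
  obtain ⟨z, hz, hvz⟩ := intermediate_value_Ioo h01.le
    (hv.continuousOn_Icc hIconn hx₀ hx₁) ⟨hv0, hv1⟩
  have hno : ∀ a ∈ Ioo x₀ x₁, ∀ b ∈ Ioo x₀ x₁, v a = 0 → v b = 0 → ¬ a < b := by
    intro a ha b hb hva hvb hab
    refine hu.not_two_zeros_of_wronskian_pos hv hIopen hIconn hνp hνm (hmem a ha) (hmem b hb) hab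
      (fun x hx => hupos x ⟨ha.1.trans_le hx.1, hx.2.trans_lt hb.2⟩) ?_ hva hvb
    rwa [← hu.wronskian_eq hv hIconn hνp hνm hx₀ (hmem a ha)]
  exact ⟨z, ⟨hz, hvz⟩, fun y hy => le_antisymm
    (not_lt.1 (hno z hz y hy.1 hvz hy.2)) (not_lt.1 (hno y hy.1 z hz hy.2 hvz))⟩
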